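/- Let ρ be a density matrix on ℂ^{N₁} ⊗ ℂ^{N₂} admitting a decomposition ρ = (1−B)ρ_sep + B ρ_ent where ρ_sep is separable, ρ_ent is a density matrix whose range contains no nonzero product vector. Then rank(ρ_ent) ≤ (N₁−1)(N₂−1). -/

import Mathlib

open scoped ComplexOrder

/-- A pure product state on ℂ^{N₁} ⊗ ℂ^{N₂}. -/
def IsPureProductState {N₁ N₂ : ℕ} (ρ : Matrix (Fin N₁ × Fin N₂) (Fin N₁ × Fin N₂) ℂ) : Prop :=
  ∃ (u : Fin N₁ → ℂ) (v : Fin N₂ → ℂ),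
    ((∑ i, ‖u i‖ ^ 2) = 1) ∧ ((∑ j, ‖v j‖ ^ 2) = 1) ∧
    ρ = Matrix.vecMulVec (fun p : Fin N₁ × Fin N₂ => u p.1 * v p.2)
      (star fun p : Fin N₁ × Fin N₂ => u p.1 * v p.2)

open MvPolynomial in
/-- The homomorphism of polynomial rings `z i j ↦ x i * y j` defining the Segre embedding. -/
noncomputable def segreHom (K : Type*) [Field K] (ι κ : Type*) :
    MvPolynomial (ι × κ) K →ₐ[K] MvPolynomial (ι ⊕ κ) K :=
  aeval fun p => X (Sum.inl p.1) * X (Sum.inr p.2)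

open MvPolynomial in
theorem segreHom_X {K : Type*} [Field K] {ι κ : Type*} (p : ι × κ) :
    segreHom K ι κ (X p) = X (Sum.inl p.1) * X (Sum.inr p.2) :=
  aeval_X _ _

open MvPolynomial in
/-- The endomorphism of a polynomial ring sending the variables in `s` to zero. -/
noncomputable def killVars (K : Type*) [Field K] {τ : Type*} (s : Set τ) :
    MvPolynomial τ K →ₐ[K] MvPolynomial τ K :=
  open Classical in aeval fun t => if t ∈ s then 0 else X t

open MvPolynomial in
theorem killVars_X {K : Type*} [Field K] {τ : Type*} (s : Set τ) (t : τ) [Decidable (t ∈ s)] :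
    killVars K s (X t) = if t ∈ s then 0 else X t := by
  simp only [killVars, aeval_X]
  congr

theorem killVars_comp_of_subset {K : Type*} [Field K] {τ : Type*} {s t : Set τ} (h : s ⊆ t) :
    (killVars K t).comp (killVars K s) = killVars K t := by
  classical
  refine MvPolynomial.algHom_ext fun x => ?_
  by_cases hs : x ∈ s
  · simp [killVars_X, hs, h hs]
  · simp [killVars_X, hs]

/-- A strictly increasing chain of `n + 1` primes bounds the height of its last member below. -/
theorem Ideal.le_height_of_chain {R : Type*} [CommRing R] (Q : ℕ → Ideal R)
    (hQ : ∀ k, (Q k).IsPrime) (n : ℕ) (hlt : ∀ k < n, Q k < Q (k + 1)) :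
    (n : ℕ∞) ≤ (Q n).height := by
  induction n with
  | zero => simp
  | succ n ih =>
    have := hQ n
    have := hQ (n + 1)
    push_cast
    exact (add_le_add_left (ih fun k hk => hlt k (hk.trans n.lt_succ_self)) 1).trans
      (Ideal.height_add_one_le_of_lt_of_isPrime (hlt n n.lt_succ_self))

/-- The stage at which a variable is killed in the chain of primes used for the lower bound on the
dimension of the Segre cone; the last `x`-variable survives until all `y`-variables are killed. -/
def segreStage (M N : ℕ) : Fin (M + 1) ⊕ Fin (N + 1) → ℕ :=
  Sum.elim (fun i => if i.val < M then i.val else M + N + 1) (fun j => M + j.val)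

/-- The kernel, in the coordinate ring of the Segre cone, of setting to zero the variables of stage
less than `k`. -/
noncomputable def segrePrime (K : Type*) [Field K] (M N k : ℕ) :
    Ideal (segreHom K (Fin (M + 1)) (Fin (N + 1))).range :=
  RingHom.ker ((killVars K {s | segreStage M N s < k}).comp
    (segreHom K (Fin (M + 1)) (Fin (N + 1))).range.val)

theorem mem_segrePrime {K : Type*} [Field K] {M N k : ℕ}
    {a : (segreHom K (Fin (M + 1)) (Fin (N + 1))).range} :
    a ∈ segrePrime K M N k ↔ killVars K {s | segreStage M N s < k} a.1 = 0 :=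
  Iff.rfl

instance segrePrime_isPrime (K : Type*) [Field K] (M N k : ℕ) : (segrePrime K M N k).IsPrime :=
  RingHom.ker_isPrime _

theorem segrePrime_lt_succ (K : Type*) [Field K] {M N k : ℕ} (hk : k < M + N + 1) :
    segrePrime K M N k < segrePrime K M N (k + 1) := by
  classical
  refine SetLike.lt_iff_le_and_exists.2 ⟨fun a ha => ?_, ?_⟩
  · rw [mem_segrePrime] at ha ⊢
    have hsub : {s | segreStage M N s < k} ⊆ {s | segreStage M N s < k + 1} :=
      fun s hs => Nat.lt_succ_of_lt hs
    rw [← killVars_comp_of_subset hsub, AlgHom.comp_apply, ha, map_zero]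
  · have key : ∃ i j, ¬ segreStage M N (.inl i) < k ∧ ¬ segreStage M N (.inr j) < k ∧
        (segreStage M N (.inl i) < k + 1 ∨ segreStage M N (.inr j) < k + 1) := by
      rcases lt_or_ge k M with h | h
      · refine ⟨⟨k, by omega⟩, 0, ?_⟩
        simp [segreStage, h, h.le]
      · refine ⟨Fin.last M, ⟨k - M, by omega⟩, ?_⟩
        simp [segreStage]
        omega
    obtain ⟨i, j, hi, hj, hij⟩ := key
    refine ⟨⟨segreHom K _ _ (MvPolynomial.X (i, j)), AlgHom.mem_range_self _ _⟩, ?_, ?_⟩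
    · rw [mem_segrePrime]
      simp only [segreHom_X, map_mul, killVars_X, Set.mem_ofPred_eq]
      rcases hij with h | h <;> simp only [h, if_true, zero_mul, mul_zero]
    · rw [mem_segrePrime]
      simp [segreHom_X, killVars_X, hi, hj]

theorem le_height_segrePrime (K : Type*) [Field K] (M N : ℕ) :
    ((M + N + 1 : ℕ) : ℕ∞) ≤ (segrePrime K M N (M + N + 1)).height :=
  Ideal.le_height_of_chain _ (fun k => segrePrime_isPrime K M N k) _
    fun _ hk => segrePrime_lt_succ K hk

theorem eval_zero_of_segreHom_mem {K : Type*} [Field K] {M N : ℕ}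
    (p : MvPolynomial (Fin (M + 1) × Fin (N + 1)) K)
    (hp : (segreHom K (Fin (M + 1)) (Fin (N + 1))).rangeRestrict p ∈
      segrePrime K M N (M + N + 1)) :
    MvPolynomial.aeval (0 : Fin (M + 1) × Fin (N + 1) → K) p = 0 := by
  classical
  rw [mem_segrePrime] at hp
  have h : ((MvPolynomial.aeval (0 : Fin (M + 1) ⊕ Fin (N + 1) → K)).comp
      ((killVars K {s | segreStage M N s < M + N + 1}).comp (segreHom K _ _))) =
      MvPolynomial.aeval (0 : Fin (M + 1) × Fin (N + 1) → K) := by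
    refine MvPolynomial.algHom_ext fun x => ?_
    have hx : segreStage M N (.inr x.2) < M + N + 1 := by
      simp [segreStage]
      omega
    simp only [AlgHom.comp_apply, segreHom_X, map_mul, killVars_X, Set.mem_ofPred_eq, hx, if_true,
      mul_zero, map_zero, MvPolynomial.aeval_X, Pi.zero_apply]
  rw [← h]
  simp only [AlgHom.comp_apply]
  exact (congrArg _ hp).trans (map_zero _)

/-- A matrix all of whose `2 × 2` minors vanish is an outer product. -/
theorem exists_mul_of_minors_eq_zero {K ι κ : Type*} [Field K] (z : ι × κ → K)
    (hz : ∀ i j k l, z (i, j) * z (k, l) = z (i, l) * z (k, j)) :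
    ∃ (u : ι → K) (v : κ → K), z = fun p => u p.1 * v p.2 := by
  by_cases h : z = 0
  · exact ⟨0, 0, by ext; simp [h]⟩
  · obtain ⟨⟨i, j⟩, hij⟩ := Function.ne_iff.1 h
    rw [Pi.zero_apply] at hij
    refine ⟨fun k => z (k, j), fun l => z (i, l) / z (i, j), funext fun ⟨k, l⟩ => ?_⟩
    field_simp
    linear_combination hz k l i j

/-- A system of at most `M + N` linear equations on `(M + 1) × (N + 1)` matrices over an
algebraically closed field has a nonzero solution which is an outer product. -/
theorem exists_mul_mem_ker {K : Type*} [Field K] [IsAlgClosed K] {M N c : ℕ} (hc : c ≤ M + N)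
    (L : (Fin (M + 1) × Fin (N + 1) → K) →ₗ[K] (Fin c → K)) :
    ∃ (u : Fin (M + 1) → K) (v : Fin (N + 1) → K),
      (fun p : Fin (M + 1) × Fin (N + 1) => u p.1 * v p.2) ∈ LinearMap.ker L ∧
      (fun p : Fin (M + 1) × Fin (N + 1) => u p.1 * v p.2) ≠ 0 := by
  classical
  by_contra! hno
  set φ := (segreHom K (Fin (M + 1)) (Fin (N + 1))).rangeRestrict
  have hsurj : Function.Surjective φ := AlgHom.rangeRestrict_surjective _
  have : IsNoetherianRing (segreHom K (Fin (M + 1)) (Fin (N + 1))).range :=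
    isNoetherianRing_of_surjective _ _ φ.toRingHom hsurj
  let b : Fin c → MvPolynomial (Fin (M + 1) × Fin (N + 1)) K := fun l =>
    ∑ p, MvPolynomial.C (L (Pi.single p 1) l) * MvPolynomial.X p
  have hb : ∀ z l, MvPolynomial.aeval z (b l) = L z l := by
    intro z l
    conv_rhs => rw [← Finset.univ_sum_single z, map_sum, Finset.sum_apply]
    simp only [b, map_sum, map_mul, MvPolynomial.aeval_C, MvPolynomial.aeval_X,
      Algebra.algebraMap_self, RingHom.id_apply]
    refine Finset.sum_congr rfl fun p _ => ?_
    rw [show Pi.single p (z p) = z p • (Pi.single p 1 : Fin (M + 1) × Fin (N + 1) → K) by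
      rw [← Pi.single_smul, smul_eq_mul, mul_one], map_smul, Pi.smul_apply, smul_eq_mul, mul_comm]
  let I := Ideal.span (Set.range fun l => φ (b l))
  let J := I.comap φ
  have hzero : MvPolynomial.zeroLocus K J ⊆ {0} := by
    intro z hz
    have hminor : ∀ i j k l, z (i, j) * z (k, l) = z (i, l) * z (k, j) := by
      intro i j k l
      have hmem : (MvPolynomial.X (i, j) * MvPolynomial.X (k, l) -
          MvPolynomial.X (i, l) * MvPolynomial.X (k, j)) ∈ J := by
        rw [Ideal.mem_comap]
        convert I.zero_mem
        apply Subtype.ext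
        change segreHom K _ _ _ = 0
        simp only [map_sub, map_mul, segreHom_X]
        ring
      simpa [sub_eq_zero] using hz _ hmem
    obtain ⟨u, v, rfl⟩ := exists_mul_of_minors_eq_zero z hminor
    refine hno u v (LinearMap.mem_ker.2 (funext fun l => ?_))
    rw [← hb]
    exact hz _ (Ideal.mem_comap.2 (Ideal.subset_span ⟨l, rfl⟩))
  have hrad : segrePrime K M N (M + N + 1) ≤ I.radical := by
    intro a ha
    obtain ⟨p, rfl⟩ := hsurj a
    have hp : p ∈ J.radical := by
      rw [← MvPolynomial.vanishingIdeal_zeroLocus_eq_radical (K := K)]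
      intro z hz
      rw [hzero hz]
      exact eval_zero_of_segreHom_mem p ha
    rwa [← Ideal.comap_radical] at hp
  have hle : I ≤ segrePrime K M N (M + N + 1) := by
    refine Ideal.span_le.2 ?_
    rintro _ ⟨l, rfl⟩
    have hx : ∀ x : Fin (N + 1), segreStage M N (.inr x) < M + N + 1 := by
      intro x
      simp [segreStage]
      omega
    rw [SetLike.mem_coe, mem_segrePrime]
    change killVars K _ (segreHom K _ _ (b l)) = 0
    simp only [b, map_sum, map_mul, segreHom_X, killVars_X, Set.mem_ofPred_eq, hx, if_true,
      mul_zero, Finset.sum_const_zero]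
  have hmin : segrePrime K M N (M + N + 1) ∈ I.minimalPrimes :=
    ⟨⟨inferInstance, hle⟩, fun P hP _ => hrad.trans (hP.1.radical_le_iff.2 hP.2)⟩
  have h₁ := Ideal.height_le_card_of_mem_minimalPrimes_span (Set.finite_range _) hmin
  have h₂ : (Set.range fun l => φ (b l)).ncard ≤ c := by
    rw [← Set.image_univ]
    exact (Set.ncard_image_le Set.finite_univ).trans (by simp [Set.ncard_univ])
  have h₃ := (le_height_segrePrime K M N).trans h₁
  have h₄ : M + N + 1 ≤ _ := Nat.cast_le.1 h₃
  omega

/-- A subspace of `(M + 1) × (N + 1)` matrices of dimension greater than `M * N` over an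
algebraically closed field contains a nonzero outer product. -/
theorem Submodule.exists_mul_mem_of_lt_finrank {K : Type*} [Field K] [IsAlgClosed K] {M N : ℕ}
    (W : Submodule K (Fin (M + 1) × Fin (N + 1) → K)) (hW : M * N < Module.finrank K W) :
    ∃ (u : Fin (M + 1) → K) (v : Fin (N + 1) → K),
      (fun p : Fin (M + 1) × Fin (N + 1) => u p.1 * v p.2) ∈ W ∧
      (fun p : Fin (M + 1) × Fin (N + 1) => u p.1 * v p.2) ≠ 0 := by
  have hdim := W.finrank_quotient_add_finrank
  rw [Module.finrank_fintype_fun_eq_card, Fintype.card_prod, Fintype.card_fin,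
    Fintype.card_fin] at hdim
  have hc : Module.finrank K ((Fin (M + 1) × Fin (N + 1) → K) ⧸ W) ≤ M + N := by
    nlinarith
  simpa using exists_mul_mem_ker hc
    ((Module.finBasis K (_ ⧸ W)).equivFun.toLinearMap ∘ₗ W.mkQ)

/-- If ρ = (1−B)ρ_sep + B ρ_ent with ρ_sep separable and ρ_ent a density matrix
whose range contains no nonzero product vector, then
rank(ρ_ent) ≤ (N₁−1)(N₂−1). -/
theorem rank_essentially_entangled_le {N₁ N₂ : ℕ}
    (ρ ρsep ρent : Matrix (Fin N₁ × Fin N₂) (Fin N₁ × Fin N₂) ℂ)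
    (hρ : ρ.PosSemidef) (htrρ : ρ.trace = 1)
    (B : ℝ) (hB0 : 0 ≤ B) (hB1 : B ≤ 1)
    (hsep : ρsep ∈ convexHull ℝ
      {σ : Matrix (Fin N₁ × Fin N₂) (Fin N₁ × Fin N₂) ℂ | IsPureProductState σ})
    (hent : ρent.PosSemidef) (htrent : ρent.trace = 1)
    (hdec : ρ = (1 - B) • ρsep + B • ρent)
    (hrange : ∀ (u : Fin N₁ → ℂ) (v : Fin N₂ → ℂ),
      (fun p : Fin N₁ × Fin N₂ => u p.1 * v p.2) ∈ LinearMap.range ρent.mulVecLin →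
      (fun p : Fin N₁ × Fin N₂ => u p.1 * v p.2) = 0) :
    ρent.rank ≤ (N₁ - 1) * (N₂ - 1) := by
  by_contra! hlt
  have hcard := ρent.rank_le_card_width
  rw [Fintype.card_prod, Fintype.card_fin, Fintype.card_fin] at hcard
  obtain _ | M := N₁
  · simp at hcard hlt
    omega
  obtain _ | N := N₂
  · simp at hcard hlt
    omega
  obtain ⟨u, v, hmem, hne⟩ :=
    (LinearMap.range ρent.mulVecLin).exists_mul_mem_of_lt_finrank (by
      rw [← Matrix.rank]
      simpa only [Nat.add_sub_cancel] using hlt)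
  exact hne (hrange u v hmem)
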